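/- Let X, Z : Ω → ℝ^n be independent random vectors with the relevant differential entropies defined. Then the element-wise (Hadamard) product satisfies h(X ⊙ Z) ≥ h(Z) + Σ_{i=1}^n E[ln |X_i|]. -/

import Mathlib

open MeasureTheory ProbabilityTheory Matrix

/-- Differential entropy of the law `μ` relative to the reference measure `ν`:
`h = -∫ log (dμ/dν) dμ` (natural logarithm). -/
noncomputable def dEnt {E : Type*} [MeasurableSpace E] (ν μ : Measure E) : ℝ :=
  -∫ x, Real.log ((μ.rnDeriv ν) x).toReal ∂μ

/-- The differential entropy of `μ` w.r.t. `ν` is (well-)defined. -/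
def dEntDefined {E : Type*} [MeasurableSpace E] (ν μ : Measure E) : Prop :=
  μ ≪ ν ∧ Integrable (fun x => Real.log ((μ.rnDeriv ν) x).toReal) μ

/-- Mutual information `I(X;Y)`: the KL divergence of the joint law of `(X, Y)`
from the product of the marginal laws. -/
noncomputable def MI {Ω E F : Type*} [MeasurableSpace Ω] [MeasurableSpace E] [MeasurableSpace F]
    (μ : Measure Ω) (X : Ω → E) (Y : Ω → F) : ℝ :=
  ∫ p, Real.log (((μ.map fun ω => (X ω, Y ω)).rnDeriv
      ((μ.map X).prod (μ.map Y))) p).toReal ∂(μ.map fun ω => (X ω, Y ω))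

/-- `I(X;Y)` is (well-)defined. -/
def MIDefined {Ω E F : Type*} [MeasurableSpace Ω] [MeasurableSpace E] [MeasurableSpace F]
    (μ : Measure Ω) (X : Ω → E) (Y : Ω → F) : Prop :=
  (μ.map fun ω => (X ω, Y ω)) ≪ ((μ.map X).prod (μ.map Y)) ∧
    Integrable (fun p => Real.log (((μ.map fun ω => (X ω, Y ω)).rnDeriv
      ((μ.map X).prod (μ.map Y))) p).toReal) (μ.map fun ω => (X ω, Y ω))

/-- Change of variables for the diagonal scaling `z ↦ x ⊙ z`, with only an inequality since `x` may
have vanishing coordinates. -/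
lemma abs_prod_mul_lintegral_hadamard_le {ι : Type*} [Fintype ι] (x : ι → ℝ)
    {G : (ι → ℝ) → ENNReal} (hG : Measurable G) :
    ENNReal.ofReal |∏ i, x i| * ∫⁻ z : ι → ℝ, G (fun i => x i * z i) ≤ ∫⁻ z, G z := by
  classical
  by_cases hx : ∏ i, x i = 0
  · simp [hx]
  have h := Real.smul_map_diagonal_volume_pi (D := x) (by rwa [det_diagonal])
  have hlin : ⇑(toLin' (diagonal x)) = fun z i => x i * z i := by
    ext z i
    simp [mulVec_diagonal]
  have hmeas : Measurable fun (z : ι → ℝ) i => x i * z i := by fun_prop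
  calc ENNReal.ofReal |∏ i, x i| * ∫⁻ z : ι → ℝ, G (fun i => x i * z i)
      = ∫⁻ z, G z ∂(ENNReal.ofReal |(diagonal x).det| •
          Measure.map (toLin' (diagonal x)) volume) := by
        rw [lintegral_smul_measure, hlin, lintegral_map hG hmeas, det_diagonal, smul_eq_mul]
    _ ≤ ∫⁻ z, G z := by rw [h]

/-- The expected likelihood ratio of the scaled density `|∏ Xᵢ| G(X ⊙ ·)` against the density of an
independent vector `Z` is at most `∫ G`. -/
lemma lintegral_hadamard_likelihood_ratio_le {Ω ι : Type*} [Fintype ι] [MeasurableSpace Ω]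
    {μ : Measure Ω} [IsProbabilityMeasure μ] {X Z : Ω → ι → ℝ}
    (hX : Measurable X) (hZ : Measurable Z) (hindep : IndepFun X Z μ)
    (hac : μ.map Z ≪ volume) {G : (ι → ℝ) → ENNReal} (hG : Measurable G) :
    ∫⁻ ω, ENNReal.ofReal |∏ i, X ω i| * G (fun i => X ω i * Z ω i) *
      ((μ.map Z).rnDeriv volume (Z ω))⁻¹ ∂μ ≤ ∫⁻ z, G z := by
  have := Measure.isProbabilityMeasure_map (μ := μ) hX.aemeasurable
  have := Measure.isProbabilityMeasure_map (μ := μ) hZ.aemeasurable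
  set F := (μ.map Z).rnDeriv volume
  have hFm : Measurable F := Measure.measurable_rnDeriv _ _
  have hmul : Measurable fun p : (ι → ℝ) × (ι → ℝ) => G (fun i => p.1 i * p.2 i) :=
    hG.comp (by fun_prop)
  let K : (ι → ℝ) × (ι → ℝ) → ENNReal := fun p =>
    ENNReal.ofReal |∏ i, p.1 i| * G (fun i => p.1 i * p.2 i) * (F p.2)⁻¹
  have hK : Measurable K := by
    have h1 : Measurable fun p : (ι → ℝ) × (ι → ℝ) => ∏ i, p.1 i := by fun_prop
    exact (((measurable_norm.comp h1).ennreal_ofReal).mul hmul).mul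
      (hFm.comp measurable_snd).inv
  have hinner (x : ι → ℝ) : ∫⁻ z, K (x, z) ∂(μ.map Z) ≤ ∫⁻ z, G z := by
    have hGx : Measurable fun z : ι → ℝ => G (fun i => x i * z i) := hG.comp (by fun_prop)
    have hKx : Measurable fun z => K (x, z) := hK.comp (by fun_prop)
    calc ∫⁻ z, K (x, z) ∂(μ.map Z)
        = ∫⁻ z, F z * K (x, z) := (lintegral_rnDeriv_mul hac hKx.aemeasurable).symm
      _ ≤ ∫⁻ z : ι → ℝ, ENNReal.ofReal |∏ i, x i| * G (fun i => x i * z i) := by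
        refine lintegral_mono fun z => ?_
        calc F z * K (x, z)
            = (ENNReal.ofReal |∏ i, x i| * G (fun i => x i * z i)) * (F z * (F z)⁻¹) := by
              simp only [K]; ring
          _ ≤ _ := mul_le_of_le_one_right' (ENNReal.mul_inv_le_one _)
      _ = ENNReal.ofReal |∏ i, x i| * ∫⁻ z : ι → ℝ, G (fun i => x i * z i) := lintegral_const_mul _ hGx
      _ ≤ ∫⁻ z, G z := abs_prod_mul_lintegral_hadamard_le x hG
  calc ∫⁻ ω, ENNReal.ofReal |∏ i, X ω i| * G (fun i => X ω i * Z ω i) * (F (Z ω))⁻¹ ∂μ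
      = ∫⁻ p, K p ∂(μ.map fun ω => (X ω, Z ω)) := (lintegral_map hK (hX.prodMk hZ)).symm
    _ = ∫⁻ x, ∫⁻ z, K (x, z) ∂(μ.map Z) ∂(μ.map X) := by
      rw [(indepFun_iff_map_prod_eq_prod_map_map hX.aemeasurable hZ.aemeasurable).1 hindep,
        lintegral_prod _ hK.aemeasurable]
    _ ≤ ∫⁻ _, (∫⁻ z, G z) ∂(μ.map X) := lintegral_mono hinner
    _ = ∫⁻ z, G z := by simp

/-- If `X ⊙ Z` has an absolutely continuous law, then almost surely no coordinate of `X` vanishes. -/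
lemma ae_forall_ne_zero_of_map_hadamard_ac {Ω ι : Type*} [Fintype ι] [MeasurableSpace Ω]
    {μ : Measure Ω} {X Z : Ω → ι → ℝ} (hX : Measurable X) (hZ : Measurable Z)
    (hac : (μ.map fun ω => fun i => X ω i * Z ω i) ≪ volume) :
    ∀ᵐ ω ∂μ, ∀ i, X ω i ≠ 0 := by
  have hW : Measurable fun ω => fun i => X ω i * Z ω i := by fun_prop
  rw [ae_all_iff]
  intro i
  have h0 : ∀ᵐ w : ι → ℝ, w i ≠ 0 := by
    rw [ae_iff]
    simpa [volume_pi] using Measure.pi_hyperplane (fun _ : ι => (volume : Measure ℝ)) i 0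
  filter_upwards [ae_of_ae_map hW.aemeasurable (hac.ae_le h0)] with ω hω h
  simp [h] at hω

/-- Let `X, Z : Ω → ℝ^n` be independent random vectors with the relevant
differential entropies defined. Then the element-wise (Hadamard) product satisfies
`h(X ⊙ Z) ≥ h(Z) + Σᵢ E[ln |Xᵢ|]`. -/
theorem entropy_hadamard_product_ge
    {Ω : Type*} [MeasurableSpace Ω] (μ : Measure Ω) [IsProbabilityMeasure μ]
    {n : ℕ} (X Z : Ω → Fin n → ℝ)
    (hX : Measurable X) (hZ : Measurable Z)
    (hindep : IndepFun X Z μ)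
    -- the relevant differential entropies are defined:
    (hhZ : dEntDefined (volume : Measure (Fin n → ℝ)) (μ.map Z))
    (hhXZ : dEntDefined (volume : Measure (Fin n → ℝ))
      (μ.map fun ω => fun i => X ω i * Z ω i))
    -- each `E[ln |Xᵢ|]` is defined:
    (hint : ∀ i : Fin n, Integrable (fun ω => Real.log |X ω i|) μ) :
    dEnt volume (μ.map fun ω => fun i => X ω i * Z ω i)
      ≥ dEnt volume (μ.map Z) + ∑ i : Fin n, ∫ ω, Real.log |X ω i| ∂μ := by
  have hW : Measurable fun ω => fun i => X ω i * Z ω i := by fun_prop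
  obtain ⟨hZac, hZint⟩ := hhZ
  obtain ⟨hWac, hWint⟩ := hhXZ
  have := Measure.isProbabilityMeasure_map (μ := μ) hZ.aemeasurable
  have := Measure.isProbabilityMeasure_map (μ := μ) hW.aemeasurable
  have hX0 := ae_forall_ne_zero_of_map_hadamard_ac hX hZ hWac
  have hratio := lintegral_hadamard_likelihood_ratio_le hX hZ hindep hZac
    (Measure.measurable_rnDeriv (μ.map fun ω => fun i => X ω i * Z ω i) volume)
  rw [Measure.lintegral_rnDeriv hWac, measure_univ] at hratio
  unfold dEnt
  set F := (μ.map Z).rnDeriv volume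
  set G := (μ.map fun ω => fun i => X ω i * Z ω i).rnDeriv volume
  have hFm : Measurable F := Measure.measurable_rnDeriv _ _
  have hGm : Measurable G := Measure.measurable_rnDeriv _ _
  have hFpos := ae_of_ae_map hZ.aemeasurable (Measure.rnDeriv_pos hZac)
  have hFtop := ae_of_ae_map hZ.aemeasurable
    (hZac.ae_le (Measure.rnDeriv_lt_top (μ.map Z) volume))
  have hGpos := ae_of_ae_map hW.aemeasurable (Measure.rnDeriv_pos hWac)
  have hGtop := ae_of_ae_map hW.aemeasurable
    (hWac.ae_le (Measure.rnDeriv_lt_top (μ.map fun ω => fun i => X ω i * Z ω i) volume))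
  have hlogF : Integrable (fun ω => Real.log (F (Z ω)).toReal) μ :=
    hZint.comp_measurable hZ
  have hlogG : Integrable (fun ω => Real.log (G (fun i => X ω i * Z ω i)).toReal) μ :=
    hWint.comp_measurable hW
  have hlogX : Integrable (fun ω => ∑ i, Real.log |X ω i|) μ :=
    integrable_finsetSum _ fun i _ => hint i
  rw [integral_map hW.aemeasurable hWint.aestronglyMeasurable,
    integral_map hZ.aemeasurable hZint.aestronglyMeasurable,
    ← integral_finsetSum _ fun i _ => hint i]
  set R : Ω → ENNReal := fun ω => ENNReal.ofReal |∏ i, X ω i| * G (fun i => X ω i * Z ω i) *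
    (F (Z ω))⁻¹
  have hRm : Measurable R := by
    have h1 : Measurable fun ω => ∏ i, X ω i := by fun_prop
    exact (((measurable_norm.comp h1).ennreal_ofReal).mul (hGm.comp hW)).mul (hFm.comp hZ).inv
  have hRne : ∫⁻ ω, R ω ∂μ ≠ ⊤ := ne_top_of_le_ne_top ENNReal.one_ne_top hratio
  have hRint : Integrable (fun ω => (R ω).toReal) μ :=
    integrable_toReal_of_lintegral_ne_top hRm.aemeasurable hRne
  have hR1 : ∫ ω, (R ω).toReal ∂μ ≤ 1 := by
    rw [integral_toReal hRm.aemeasurable (ae_lt_top hRm hRne)]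
    exact ENNReal.toReal_le_of_le_ofReal zero_le_one (by simpa using hratio)
  have hgibbs : ∀ᵐ ω ∂μ, Real.log (G (fun i => X ω i * Z ω i)).toReal + ∑ i, Real.log |X ω i| -
      Real.log (F (Z ω)).toReal ≤ (R ω).toReal - 1 := by
    filter_upwards [hX0, hFpos, hFtop, hGpos, hGtop] with ω hx hf hf' hg hg'
    have hf0 := ENNReal.toReal_pos hf.ne' hf'.ne
    have hg0 := ENNReal.toReal_pos hg.ne' hg'.ne
    have hp0 : 0 < |∏ i, X ω i| := abs_pos.2 (Finset.prod_ne_zero_iff.2 fun i _ => hx i)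
    have hR : (R ω).toReal =
        |∏ i, X ω i| * (G (fun i => X ω i * Z ω i)).toReal * ((F (Z ω)).toReal)⁻¹ := by
      simp [R, ENNReal.toReal_mul, ENNReal.toReal_inv]
    have hlogprod : Real.log |∏ i, X ω i| = ∑ i, Real.log |X ω i| := by
      rw [Finset.abs_prod, Real.log_prod fun i _ => abs_ne_zero.2 (hx i)]
    have hle := Real.log_le_sub_one_of_pos (x := (R ω).toReal) (by rw [hR]; positivity)
    have hlog : Real.log (R ω).toReal = Real.log |∏ i, X ω i| +
        Real.log (G (fun i => X ω i * Z ω i)).toReal - Real.log (F (Z ω)).toReal := by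
      rw [hR, Real.log_mul (by positivity) (by positivity), Real.log_mul hp0.ne' hg0.ne',
        Real.log_inv]
      ring
    linarith
  have hmono := integral_mono_ae ((hlogG.add hlogX).sub hlogF)
    (hRint.sub (integrable_const 1)) hgibbs
  rw [integral_sub' (hlogG.add hlogX) hlogF, integral_add' hlogG hlogX,
    integral_sub' hRint (integrable_const 1), integral_const, probReal_univ, one_smul] at hmono
  linarith
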